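/- Let G be a graph on n ≥ 2 vertices, k ≥ 1 and ℓ ≥ 0 integers, and let G' with terminals s, t be the pair-copies graph of G. Then G contains a path P with at least two vertices such that |V(P)| ≥ k and |N_G(V(P))| ≥ ℓ if and only if G' contains an st-path P' with |V(P')| ≥ k + 2 and |N_{G'}(V(P'))| ≥ ℓ + 2(binom(n,2) − 1). -/

import Mathlib

open SimpleGraph

/-- The open neighborhood of a vertex set `S`: vertices outside `S` adjacent to some
vertex of `S`. -/
def openNbhd {V : Type*} (G : SimpleGraph V) (S : Set V) : Set V :=
  {v | v ∉ S ∧ ∃ w ∈ S, G.Adj v w}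

/-- The pair-copies graph `G'` of a graph `G` with a linear order on its vertices:
for every pair `v < w` of vertices of `G` there is a disjoint copy of `G`
(modelled as `Sum.inl (⟨(v, w), _⟩, a)` for `a : V`), together with two new
vertices `s = Sum.inr false` and `t = Sum.inr true`, where `s` is adjacent exactly
to the copy of `v` in each copy `G_{vw}`, and `t` is adjacent exactly to the copy
of `w` in each copy `G_{vw}`. -/
def pairCopies {V : Type*} [LinearOrder V] (G : SimpleGraph V) :
    SimpleGraph (({q : V × V // q.1 < q.2} × V) ⊕ Bool) :=
  SimpleGraph.fromRel (fun a b =>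
    match a, b with
    | Sum.inl (e, a), Sum.inl (e', b) => e = e' ∧ G.Adj a b
    | Sum.inr false, Sum.inl (e, a) => a = e.1.1
    | Sum.inr true, Sum.inl (e, a) => a = e.1.2
    | _, _ => False)

section PairCopies

variable {V : Type*} [LinearOrder V] {G : SimpleGraph V}

@[simp]
theorem pairCopies_adj_inl_inl {e e' : {q : V × V // q.1 < q.2}} {a b : V} :
    (pairCopies G).Adj (Sum.inl (e, a)) (Sum.inl (e', b)) ↔ e = e' ∧ G.Adj a b := by
  simp only [pairCopies, SimpleGraph.fromRel_adj]
  constructor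
  · rintro ⟨-, h | h⟩
    · exact h
    · exact ⟨h.1.symm, h.2.symm⟩
  · rintro ⟨rfl, h⟩
    exact ⟨by simpa using h.ne, Or.inl ⟨rfl, h⟩⟩

@[simp]
theorem pairCopies_adj_inl_false {e : {q : V × V // q.1 < q.2}} {a : V} :
    (pairCopies G).Adj (Sum.inl (e, a)) (Sum.inr false) ↔ a = e.1.1 := by
  simp [pairCopies, SimpleGraph.fromRel_adj]

@[simp]
theorem pairCopies_adj_inl_true {e : {q : V × V // q.1 < q.2}} {a : V} :
    (pairCopies G).Adj (Sum.inl (e, a)) (Sum.inr true) ↔ a = e.1.2 := by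
  simp [pairCopies, SimpleGraph.fromRel_adj]

@[simp]
theorem not_pairCopies_adj_inr_inr {x y : Bool} :
    ¬ (pairCopies G).Adj (Sum.inr x) (Sum.inr y) := by
  cases x <;> cases y <;> simp [pairCopies, SimpleGraph.fromRel_adj]

/-- The inclusion of the copy of `G` indexed by the pair `e` into the pair-copies graph. -/
def pairCopiesHom (G : SimpleGraph V) (e : {q : V × V // q.1 < q.2}) : G →g pairCopies G where
  toFun a := Sum.inl (e, a)
  map_rel' h := pairCopies_adj_inl_inl.2 ⟨rfl, h⟩

@[simp]
theorem pairCopiesHom_apply (e : {q : V × V // q.1 < q.2}) (a : V) :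
    pairCopiesHom G e a = Sum.inl (e, a) := rfl

theorem pairCopiesHom_injective (e : {q : V × V // q.1 < q.2}) :
    Function.Injective (pairCopiesHom G e) := fun a b h => by simpa using h

/-- A path into the terminal `t` avoiding the terminal `s` stays in one copy of `G`. -/
theorem exists_walk_of_isPath_to_terminal {x y : ({q : V × V // q.1 < q.2} × V) ⊕ Bool}
    (q : (pairCopies G).Walk x y) (hq : q.IsPath) (hs : Sum.inr false ∉ q.support)
    (e : {q : V × V // q.1 < q.2}) (a : V) (hx : x = Sum.inl (e, a)) (hy : y = Sum.inr true) :
    ∃ r : G.Walk a e.1.2, q.support = r.support.map (pairCopiesHom G e) ++ [Sum.inr true] := by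
  induction q generalizing a with
  | nil => subst hx; cases hy
  | @cons u v w h q ih =>
    subst hx
    rw [SimpleGraph.Walk.cons_isPath_iff] at hq
    rw [SimpleGraph.Walk.support_cons, List.mem_cons, not_or] at hs
    rcases v with ⟨e', b⟩ | (_ | _)
    · obtain ⟨rfl, hab⟩ := pairCopies_adj_inl_inl.1 h
      obtain ⟨r, hr⟩ := ih hq.1 hs.2 b rfl hy
      exact ⟨SimpleGraph.Walk.cons hab r, by simp [hr]⟩
    · exact absurd q.start_mem_support hs.2
    · obtain rfl := pairCopies_adj_inl_true.1 h
      subst hy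
      obtain rfl := (SimpleGraph.Walk.isPath_iff_nil.1 hq.1).eq_nil
      exact ⟨SimpleGraph.Walk.nil, by simp⟩

/-- An `st`-path of the pair-copies graph consists of the terminals and a path of `G` inside the
copy of `G` indexed by the pair of its endpoints. -/
theorem exists_isPath_of_isPath_pairCopies
    (p : (pairCopies G).Walk (Sum.inr false) (Sum.inr true)) (hp : p.IsPath) :
    ∃ (e : {q : V × V // q.1 < q.2}) (r : G.Walk e.1.1 e.1.2), r.IsPath ∧
      p.support = Sum.inr false :: (r.support.map (pairCopiesHom G e) ++ [Sum.inr true]) := by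
  cases p with
  | @cons u v w h q =>
    have hp' := (SimpleGraph.Walk.cons_isPath_iff _ _).1 hp
    rcases v with ⟨e, a⟩ | x
    · obtain rfl := pairCopies_adj_inl_false.1 h.symm
      obtain ⟨r, hr⟩ := exists_walk_of_isPath_to_terminal q hp'.1 hp'.2 e _ rfl rfl
      refine ⟨e, r, ?_, by simp [hr]⟩
      have := hp'.1.support_nodup
      rw [hr] at this
      exact SimpleGraph.Walk.IsPath.mk' (this.of_append_left.of_map _)
    · exact absurd h not_pairCopies_adj_inr_inr

/-- A path of `G` joining the two vertices of a pair `e` extends to an `st`-path of the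
pair-copies graph through the copy of `G` indexed by `e`. -/
theorem exists_isPath_pairCopies_of_isPath (e : {q : V × V // q.1 < q.2})
    (r : G.Walk e.1.1 e.1.2) (hr : r.IsPath) :
    ∃ p : (pairCopies G).Walk (Sum.inr false) (Sum.inr true), p.IsPath ∧
      p.support = Sum.inr false :: (r.support.map (pairCopiesHom G e) ++ [Sum.inr true]) := by
  have hs : (pairCopies G).Adj (Sum.inr false) (pairCopiesHom G e e.1.1) :=
    (pairCopies_adj_inl_false.2 rfl).symm
  have ht : (pairCopies G).Adj (pairCopiesHom G e e.1.2) (Sum.inr true) :=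
    pairCopies_adj_inl_true.2 rfl
  have hsupp : (SimpleGraph.Walk.cons hs ((r.map (pairCopiesHom G e)).concat ht)).support =
      Sum.inr false :: (r.support.map (pairCopiesHom G e) ++ [Sum.inr true]) := by
    rw [SimpleGraph.Walk.support_cons, SimpleGraph.Walk.support_concat,
      SimpleGraph.Walk.support_map]
  refine ⟨_, SimpleGraph.Walk.IsPath.mk' ?_, hsupp⟩
  rw [hsupp]
  have := hr.support_nodup.map (pairCopiesHom_injective (G := G) e)
  simp [List.nodup_append, this]

theorem openNbhd_pairCopies (e : {q : V × V // q.1 < q.2}) (S : Set V)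
    (h₁ : e.1.1 ∈ S) (h₂ : e.1.2 ∈ S) :
    openNbhd (pairCopies G) (pairCopiesHom G e '' S ∪ Set.range Sum.inr) =
      pairCopiesHom G e '' openNbhd G S ∪
        ((fun e' => Sum.inl (e', e'.1.1)) '' {e}ᶜ ∪ (fun e' => Sum.inl (e', e'.1.2)) '' {e}ᶜ) := by
  ext x
  rcases x with ⟨e', a⟩ | x
  · by_cases he : e' = e
    · subst he
      simp [openNbhd]
      grind
    · simp [openNbhd, he, Ne.symm he]
      grind
  · simp [openNbhd]

theorem ncard_openNbhd_pairCopies [Fintype V] (e : {q : V × V // q.1 < q.2}) (S : Set V)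
    (h₁ : e.1.1 ∈ S) (h₂ : e.1.2 ∈ S) :
    (openNbhd (pairCopies G) (pairCopiesHom G e '' S ∪ Set.range Sum.inr)).ncard =
      (openNbhd G S).ncard + 2 * (Nat.card {q : V × V // q.1 < q.2} - 1) := by
  have hc : ({e}ᶜ : Set {q : V × V // q.1 < q.2}).ncard =
      Nat.card {q : V × V // q.1 < q.2} - 1 := by
    rw [Set.ncard_compl, Set.ncard_singleton]
  rw [openNbhd_pairCopies e S h₁ h₂, Set.ncard_union_eq, Set.ncard_union_eq,
    Set.ncard_image_of_injective _ (pairCopiesHom_injective e), Set.ncard_image_of_injective,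
    Set.ncard_image_of_injective, hc, two_mul]
  · intro a b h
    simpa using congrArg (Sum.elim Prod.fst fun _ => e) h
  · intro a b h
    simpa using congrArg (Sum.elim Prod.fst fun _ => e) h
  · rw [Set.disjoint_left]
    rintro _ ⟨a, -, rfl⟩ ⟨b, -, h⟩
    simp only [Sum.inl.injEq, Prod.mk.injEq] at h
    obtain ⟨rfl, h⟩ := h
    exact b.2.ne' h
  · rw [Set.disjoint_left]
    rintro _ ⟨a, -, rfl⟩ (⟨b, hb, h⟩ | ⟨b, hb, h⟩) <;>
    · simp only [pairCopiesHom_apply, Sum.inl.injEq, Prod.mk.injEq] at h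
      exact hb h.1

/-- The neighborhood of an `st`-path running through the copy of `G` indexed by `e`. -/
theorem ncard_openNbhd_support [Fintype V] {e : {q : V × V // q.1 < q.2}}
    {r : G.Walk e.1.1 e.1.2} {p : (pairCopies G).Walk (Sum.inr false) (Sum.inr true)}
    (h : p.support = Sum.inr false :: (r.support.map (pairCopiesHom G e) ++ [Sum.inr true])) :
    (openNbhd (pairCopies G) {x | x ∈ p.support}).ncard =
      (openNbhd G {x | x ∈ r.support}).ncard +
        2 * (Nat.card {q : V × V // q.1 < q.2} - 1) := by
  rw [← ncard_openNbhd_pairCopies e _ r.start_mem_support r.end_mem_support]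
  congr 2
  ext x
  rcases x with x | (_ | _) <;> simp [h]

theorem card_pairs_lt [Fintype V] :
    Nat.card {q : V × V // q.1 < q.2} = (Fintype.card V).choose 2 := by
  let f : {q : V × V // q.1 < q.2} → {z : Sym2 V // ¬ z.IsDiag} :=
    fun q => ⟨s(q.1.1, q.1.2), by simpa using q.2.ne⟩
  have hf : Function.Bijective f := by
    constructor
    · rintro ⟨⟨a, b⟩, hab⟩ ⟨⟨c, d⟩, hcd⟩ h
      simp only [f, Subtype.mk.injEq, Sym2.eq_iff] at h
      obtain ⟨rfl, rfl⟩ | ⟨rfl, rfl⟩ := h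
      · rfl
      · exact absurd hab (lt_asymm hcd)
    · rintro ⟨z, hz⟩
      induction z with
      | _ a b =>
        rcases lt_or_gt_of_ne (by simpa using hz : a ≠ b) with h | h
        · exact ⟨⟨(a, b), h⟩, rfl⟩
        · exact ⟨⟨(b, a), h⟩, Subtype.ext Sym2.eq_swap⟩
  rw [Nat.card_congr (Equiv.ofBijective f hf), Nat.card_eq_fintype_card,
    Sym2.card_subtype_not_diag]

end PairCopies

/-- Long unsecluded: |V(P)| ≥ k, |N| ≥ ℓ iff ... in G'. -/
theorem stmt_12 {V : Type*} [Fintype V] [LinearOrder V] (G : SimpleGraph V)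
    (hn : 2 ≤ Fintype.card V) (k ℓ : ℕ) (hk : 1 ≤ k) :
    (∃ (u v : V) (p : G.Walk u v), p.IsPath ∧ 2 ≤ p.support.length ∧
        k ≤ p.support.length ∧ ℓ ≤ (openNbhd G {x | x ∈ p.support}).ncard) ↔
      (∃ p' : (pairCopies G).Walk (Sum.inr false) (Sum.inr true), p'.IsPath ∧
        k + 2 ≤ p'.support.length ∧ ℓ + 2 * ((Fintype.card V).choose 2 - 1) ≤ (openNbhd (pairCopies G) {x | x ∈ p'.support}).ncard) := by
  constructor
  · rintro ⟨u, v, p, hp, h2, hkp, hℓ⟩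
    obtain ⟨e, r, hr, hlen, hset⟩ : ∃ (e : {q : V × V // q.1 < q.2}) (r : G.Walk e.1.1 e.1.2),
        r.IsPath ∧ r.support.length = p.support.length ∧
          {x | x ∈ r.support} = {x | x ∈ p.support} := by
      have huv : u ≠ v := by
        rintro rfl
        obtain rfl := (SimpleGraph.Walk.isPath_iff_nil.1 hp).eq_nil
        simp at h2
      rcases lt_or_gt_of_ne huv with h | h
      · exact ⟨⟨(u, v), h⟩, p, hp, rfl, rfl⟩
      · exact ⟨⟨(v, u), h⟩, p.reverse, hp.reverse, by simp, by simp⟩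
    obtain ⟨p', hp', hsupp⟩ := exists_isPath_pairCopies_of_isPath e r hr
    refine ⟨p', hp', ?_, ?_⟩
    · simp only [hsupp, List.length_cons, List.length_append, List.length_map, List.length_nil]
      omega
    · rw [ncard_openNbhd_support hsupp, card_pairs_lt, hset]
      omega
  · rintro ⟨p', hp', hkp, hℓ⟩
    obtain ⟨e, r, hr, hsupp⟩ := exists_isPath_of_isPath_pairCopies p' hp'
    rw [ncard_openNbhd_support hsupp, card_pairs_lt] at hℓ
    simp only [hsupp, List.length_cons, List.length_append, List.length_map,
      List.length_nil] at hkp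
    refine ⟨e.1.1, e.1.2, r, hr, ?_, by omega, by omega⟩
    have hpos : r.length ≠ 0 := fun h => e.2.ne (SimpleGraph.Walk.eq_of_length_eq_zero h)
    rw [SimpleGraph.Walk.length_support]
    omega
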